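/- arXiv:2210.07520 — 2 statements merged into one kernel-verified Lean document; each statement's English description precedes it below -/
import Mathlib

section
/- For the numerical semigroup S minimally generated by the geometric sequence a^r, a^{r−1}b, …, b^r (with gcd(a,b) = 1, a < b), both the semigroup ring k[S] and its projective closure ring k[z_0,…,z_{r+1}]/ker(η^h) are complete intersections; that is, the height of the defining ideal equals its minimal number of generators in each case. -/
open MvPolynomial CategoryTheory

set_option maxHeartbeats 1000000
set_option synthInstance.maxHeartbeats 400000

noncomputable section

namespace AffineSG

/-- The total degree of an exponent vector. -/
def edeg {n : ℕ} (u : Fin n →₀ ℕ) : ℕ := u.sum fun _ e => e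

/-- `ndrlGT u v` means that the monomial with exponent vector `u` is strictly greater than
the one with exponent vector `v` in the negative degree reverse lexicographic order induced by
`z_n > ⋯ > z_1` (the variable with larger index is the larger variable). -/
def ndrlGT {n : ℕ} (u v : Fin n →₀ ℕ) : Prop :=
  edeg u < edeg v ∨
    (edeg u = edeg v ∧ ∃ i : Fin n, u i < v i ∧ ∀ j : Fin n, j < i → u j = v j)

/-- `IsLM f m` : the exponent vector `m` is the leading monomial of `f` with respect to the
negative degree reverse lexicographic order. -/
def IsLM {n : ℕ} {k : Type} [Field k] (f : MvPolynomial (Fin n) k) (m : Fin n →₀ ℕ) : Prop :=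
  m ∈ f.support ∧ ∀ m' ∈ f.support, m' ≠ m → ndrlGT m m'

/-- `G` is a Gröbner (standard) basis of `I` with respect to the negative degree reverse
lexicographic order: `G ⊆ I` and the leading monomial of every nonzero element of `I` is
divisible by the leading monomial of some element of `G`. -/
def IsGroebnerBasis {n : ℕ} {k : Type} [Field k] (G : Finset (MvPolynomial (Fin n) k))
    (I : Ideal (MvPolynomial (Fin n) k)) : Prop :=
  (↑G : Set (MvPolynomial (Fin n) k)) ⊆ (I : Set (MvPolynomial (Fin n) k)) ∧
    ∀ f ∈ I, f ≠ 0 → ∃ g ∈ G, ∃ mg mf, IsLM g mg ∧ IsLM f mf ∧ mg ≤ mf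

/-- A minimal Gröbner basis: a Gröbner basis consisting of nonzero polynomials no leading
monomial of which divides the leading monomial of another element. -/
def IsMinimalGroebnerBasis {n : ℕ} {k : Type} [Field k] (G : Finset (MvPolynomial (Fin n) k))
    (I : Ideal (MvPolynomial (Fin n) k)) : Prop :=
  IsGroebnerBasis G I ∧ (0 : MvPolynomial (Fin n) k) ∉ G ∧
    ∀ g ∈ G, ∀ g' ∈ G, g ≠ g' → ∀ mg mg', IsLM g mg → IsLM g' mg' → ¬ mg ≤ mg'

/-- The toric ideal (defining ideal) attached to a family `g` of lattice points in `ℕ^d`: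
the kernel of `z_i ↦ x^{g i}`. -/
def famIdeal (k : Type) [Field k] {n d : ℕ} (g : Fin n → (Fin d → ℕ)) :
    Ideal (MvPolynomial (Fin n) k) :=
  RingHom.ker (MvPolynomial.aeval
    (fun i => MvPolynomial.monomial (Finsupp.equivFunOnFinite.symm (g i)) (1 : k)) :
      MvPolynomial (Fin n) k →ₐ[k] MvPolynomial (Fin d) k)

/-- A simplicial affine semigroup fully embedded in `ℕ^d`, minimally generated by
`gen 0, …, gen (d+r-1)`, whose set of extremal rays consists of the first `d` generators. -/
structure SimplicialAffineSemigroup (d r : ℕ) where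
  gen : Fin (d + r) → (Fin d → ℕ)
  gen_ne_zero : ∀ i, gen i ≠ 0
  li : LinearIndependent ℚ (fun (i : Fin d) (j : Fin d) => ((gen (Fin.castAdd r i) j : ℚ)))
  cone : ∀ i : Fin (d + r), ∃ c : Fin d → ℚ, (∀ j, 0 ≤ c j) ∧
    (fun j => (gen i j : ℚ)) = ∑ j : Fin d, c j • (fun l => (gen (Fin.castAdd r j) l : ℚ))
  minimal : ∀ i, gen i ∉ AddSubmonoid.closure (Set.range gen \ {gen i})

namespace SimplicialAffineSemigroup

variable {d r : ℕ}

/-- The underlying semigroup (as a set): the additive submonoid generated by the generators. -/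
def mem (S : SimplicialAffineSemigroup d r) (s : Fin d → ℕ) : Prop :=
  s ∈ AddSubmonoid.closure (Set.range S.gen)

/-- The defining ideal `I(S)` of the semigroup ring `k[S]`. -/
def definingIdeal (k : Type) [Field k] (S : SimplicialAffineSemigroup d r) :
    Ideal (MvPolynomial (Fin (d + r)) k) :=
  famIdeal k S.gen

end SimplicialAffineSemigroup

/-- The smallest degree of a monomial appearing in `f`. -/
def minDeg {n : ℕ} {k : Type} [Field k] (f : MvPolynomial (Fin n) k) : ℕ :=
  sInf (edeg '' (f.support : Set (Fin n →₀ ℕ)))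

/-- The initial form `f*` of `f`: the homogeneous component of least degree of `f`. -/
def initialForm {n : ℕ} {k : Type} [Field k] (f : MvPolynomial (Fin n) k) :
    MvPolynomial (Fin n) k :=
  MvPolynomial.homogeneousComponent (minDeg f) f

/-- `I*`, the ideal generated by the initial forms of the elements of `I`;
one has `gr_𝔪(A/I) ≅ A/I*`. -/
def starIdeal {n : ℕ} {k : Type} [Field k] (I : Ideal (MvPolynomial (Fin n) k)) :
    Ideal (MvPolynomial (Fin n) k) :=
  Ideal.span { g | ∃ f ∈ I, f ≠ 0 ∧ g = initialForm f }

/-- A finite set `J ⊆ I` is a standard basis of `I` if the initial forms of its elements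
generate `I*`. -/
def IsStandardBasis {n : ℕ} {k : Type} [Field k] (J : Finset (MvPolynomial (Fin n) k))
    (I : Ideal (MvPolynomial (Fin n) k)) : Prop :=
  (↑J : Set (MvPolynomial (Fin n) k)) ⊆ (I : Set (MvPolynomial (Fin n) k)) ∧
    starIdeal I = Ideal.span (initialForm '' (↑J : Set (MvPolynomial (Fin n) k)))

/-- The ideal of a commutative ring generated by the images of the variables under the
quotient map; for `A/I` this is the distinguished (graded) maximal ideal `𝔪`. -/
def quotMax {n : ℕ} {k : Type} [Field k] (I : Ideal (MvPolynomial (Fin n) k)) :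
    Ideal (MvPolynomial (Fin n) k ⧸ I) :=
  Ideal.map (Ideal.Quotient.mk I) (Ideal.span (Set.range (MvPolynomial.X : Fin n → MvPolynomial (Fin n) k)))

/-- `J` is a reduction ideal of `I`: `J ⊆ I` and `J I^n = I^{n+1}` for all large `n`. -/
def IsReductionIdeal {R : Type} [CommRing R] (J I : Ideal R) : Prop :=
  J ≤ I ∧ ∃ N : ℕ, ∀ n ≥ N, J * I ^ n = I ^ (n + 1)

/-- A commutative ring `R` with distinguished (maximal) ideal `m` is Cohen–Macaulay if
there is a regular sequence on `R` consisting of elements of `m` whose length is the Krull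
dimension of `R`. -/
def IsCM (R : Type) [CommRing R] (m : Ideal R) : Prop :=
  ∃ rs : List R, (∀ x ∈ rs, x ∈ m) ∧ RingTheory.Sequence.IsRegular R rs ∧
    ringKrullDim R = rs.length

/-- The depth of `R` with respect to the ideal `m`: the supremum of the lengths of regular
sequences on `R` consisting of elements of `m`. -/
def ringDepth (R : Type) [CommRing R] (m : Ideal R) : ℕ∞ :=
  sSup ((fun rs : List R => (rs.length : ℕ∞)) ''
    { rs : List R | (∀ x ∈ rs, x ∈ m) ∧ RingTheory.Sequence.IsRegular R rs })

/-- The length of a module, realized as the Krull dimension of its lattice of submodules. -/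
def moduleLength (R M : Type) [CommRing R] [AddCommGroup M] [Module R M] : WithBot ℕ∞ :=
  Order.krullDim (Submodule R M)

/-- The `i`-th Betti number of the `R`-module `M` with respect to the distinguished maximal
ideal `m`, namely the length of `Tor_i^R(R/m, M)`. -/
def bettiNumber (R : Type) [CommRing R] (m : Ideal R) (M : Type) [AddCommGroup M] [Module R M]
    (i : ℕ) : WithBot ℕ∞ :=
  moduleLength R (((Tor (ModuleCat R) i).obj (ModuleCat.of R (R ⧸ m))).obj (ModuleCat.of R M))

/-- The height of an ideal. -/
def idealHeight {R : Type} [CommRing R] (I : Ideal R) : ℕ∞ :=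
  sInf { n : ℕ∞ | ∃ p : PrimeSpectrum R, I ≤ p.asIdeal ∧ n = Order.height p }

/-- The minimal number of generators of an ideal. -/
def mu {R : Type} [CommRing R] (I : Ideal R) : ℕ∞ :=
  sInf { n : ℕ∞ | ∃ s : Finset R, (s.card : ℕ∞) = n ∧ Ideal.span (↑s : Set R) = I }

/-- An ideal `I` of a polynomial ring is a complete intersection if its height equals its
minimal number of generators. -/
def IsCompleteIntersectionIdeal {R : Type} [CommRing R] (I : Ideal R) : Prop :=
  idealHeight I = mu I


/-- `p` is a factorization of `s` in terms of the generating family `g`. -/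
def FamFactorization {n d : ℕ} (g : Fin n → (Fin d → ℕ)) (p : Fin n → ℕ) (s : Fin d → ℕ) :
    Prop :=
  ∑ i, p i • g i = s

/-- `s` belongs to the affine semigroup generated by the family `g`. -/
def FamMem {n d : ℕ} (g : Fin n → (Fin d → ℕ)) (s : Fin d → ℕ) : Prop :=
  ∃ p, FamFactorization g p s

/-- `s` belongs to the Apéry set `AP(S,E)` of the semigroup generated by `g`, where the set of
extremal rays `E` consists of the first `d` members of the family. -/
def FamApery {d m : ℕ} (g : Fin (d + m) → (Fin d → ℕ)) (s : Fin d → ℕ) : Prop :=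
  FamMem g s ∧ ∀ i : Fin d, ¬ ∃ t, FamMem g t ∧ t + g (Fin.castAdd m i) = s

/-- The semigroup generated by `g` (first `d` members extremal rays) is homogeneous: every
nonzero element of the Apéry set with respect to the extremal rays has all its factorizations
of the same length. -/
def FamHomogeneous {d m : ℕ} (g : Fin (d + m) → (Fin d → ℕ)) : Prop :=
  ∀ s, FamApery g s → s ≠ 0 → ∀ p q, FamFactorization g p s → FamFactorization g q s →
    ∑ i, p i = ∑ i, q i

/-- `p` is a maximal factorization: no factorization of the same semigroup element has
strictly larger length (so the length of `p` is the order of the element). -/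
def IsMaximalFactorization {n d : ℕ} (g : Fin n → (Fin d → ℕ)) (p : Fin n → ℕ) : Prop :=
  ∀ q, FamFactorization g q (∑ i, p i • g i) → ∑ i, q i ≤ ∑ i, p i

/-- The projection `π_e` killing the `e` smallest variables `z_1, …, z_e`. -/
def proj (k : Type) [Field k] (n e : ℕ) :
    MvPolynomial (Fin n) k →ₐ[k] MvPolynomial (Fin (n - e)) k :=
  MvPolynomial.aeval fun j : Fin n =>
    if hj : e ≤ (j : ℕ) then
      MvPolynomial.X (⟨(j : ℕ) - e, by have := j.isLt; omega⟩ : Fin (n - e))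
    else 0

/-- The generating family of the extension `S_b = λS ∪ {μb}` of the semigroup generated by
`g`, where `b = Σ α_i g i`. -/
def extFam {d r : ℕ} (g : Fin (d + r) → (Fin d → ℕ)) (α : Fin (d + r) → ℕ) (lam mu : ℕ) :
    Fin (d + (r + 1)) → (Fin d → ℕ) :=
  Fin.snoc (fun i => lam • g i) (mu • ∑ i, α i • g i)

/-- Generating families of simplicial affine semigroups obtained from `ℕ^d` by a finite
sequence of nice extensions. -/
inductive NiceSeq (d : ℕ) : ∀ r : ℕ, (Fin (d + r) → (Fin d → ℕ)) → Prop
  | base : NiceSeq d 0 (fun i j => if (i : ℕ) = (j : ℕ) then 1 else 0)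
  | step {r : ℕ} {g : Fin (d + r) → (Fin d → ℕ)} (α : Fin (d + r) → ℕ) (lam mu : ℕ)
      (hg : NiceSeq d r g) (hco : Nat.Coprime lam mu) (hnice : lam ≤ ∑ i, α i) :
      NiceSeq d (r + 1) (extFam g α lam mu)


/-- The ideal of `A/I` generated by the images of the variables corresponding to the
extremal rays (the first `d` variables). -/
def quotExtremal (d r : ℕ) (k : Type) [Field k] (I : Ideal (MvPolynomial (Fin (d + r)) k)) :
    Ideal (MvPolynomial (Fin (d + r)) k ⧸ I) :=
  Ideal.map (Ideal.Quotient.mk I)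
    (Ideal.span (Set.range fun i : Fin d =>
      (MvPolynomial.X (Fin.castAdd r i) : MvPolynomial (Fin (d + r)) k)))

end AffineSG
/-- The defining ideal `𝔭` of the monomial curve given by the numerical semigroup minimally
generated by the geometric sequence `m_i = a^{r+1-i} b^{i-1}`, `i = 1, …, r+1`:
the kernel of `z_i ↦ t^{m_i}`. -/
noncomputable def geomKer (k : Type) [Field k] (a b r : ℕ) :
    Ideal (MvPolynomial (Fin (r + 1)) k) :=
  RingHom.ker (MvPolynomial.aeval
    (fun i : Fin (r + 1) =>
      (Polynomial.X : Polynomial k) ^ (a ^ (r - (i : ℕ)) * b ^ (i : ℕ))) :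
        MvPolynomial (Fin (r + 1)) k →ₐ[k] Polynomial k)

/-- The binomials `P_i = z_{i+1}^a − z_i^b`, `i = 1, …, r`. -/
noncomputable def geomP (k : Type) [Field k] (a b r : ℕ) (i : Fin r) :
    MvPolynomial (Fin (r + 1)) k :=
  MvPolynomial.X i.succ ^ a - MvPolynomial.X i.castSucc ^ b
/-- The defining ideal of the projective closure of the monomial curve: the kernel of
`η^h : k[z_0,…,z_{r+1}] → k[u,v]`, `z_0 ↦ v^{m_{r+1}}`, `z_i ↦ u^{m_i} v^{m_{r+1}−m_i}`
(here variable `0` of `Fin (r+2)` plays the role of `z_0`, and `u = X 0`, `v = X 1`). -/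
noncomputable def geomProjKer (k : Type) [Field k] (a b r : ℕ) :
    Ideal (MvPolynomial (Fin (r + 2)) k) :=
  RingHom.ker (MvPolynomial.aeval
    (fun j : Fin (r + 2) =>
      Fin.cases ((MvPolynomial.X 1 : MvPolynomial (Fin 2) k) ^ (b ^ r))
        (fun i : Fin (r + 1) =>
          (MvPolynomial.X 0 : MvPolynomial (Fin 2) k) ^ (a ^ (r - (i : ℕ)) * b ^ (i : ℕ)) *
            (MvPolynomial.X 1 : MvPolynomial (Fin 2) k) ^
              (b ^ r - a ^ (r - (i : ℕ)) * b ^ (i : ℕ))) j) :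
        MvPolynomial (Fin (r + 2)) k →ₐ[k] MvPolynomial (Fin 2) k)

namespace AffineSG

/-- For a prime ideal, `idealHeight` agrees with `Ideal.height`. -/
theorem idealHeight_eq_height {R : Type} [CommRing R] (I : Ideal R) [hI : I.IsPrime] :
    idealHeight I = I.height := by
  have key := PrimeSpectrum.height_eq_orderHeight (⟨I, hI⟩ : PrimeSpectrum R)
  refine le_antisymm (sInf_le ⟨⟨I, hI⟩, le_rfl, key⟩) (le_sInf ?_)
  rintro _ ⟨p, hp, rfl⟩
  rw [← PrimeSpectrum.height_eq_orderHeight]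
  exact Ideal.height_mono hp

/-- A prime ideal of a Noetherian ring generated by `r` elements and of height at least `r` is a
complete intersection. -/
theorem isCompleteIntersectionIdeal_of_le_height {R : Type} [CommRing R] [IsNoetherianRing R]
    (I : Ideal R) [hI : I.IsPrime] {r : ℕ} (f : Fin r → R)
    (hf : Ideal.span (Set.range f) = I) (hr : (r : ℕ∞) ≤ I.height) :
    IsCompleteIntersectionIdeal I := by
  classical
  rw [IsCompleteIntersectionIdeal, idealHeight_eq_height]
  refine le_antisymm (le_sInf ?_) ?_
  · rintro _ ⟨s, rfl, hs⟩
    calc I.height ≤ I.spanRank.toENat := I.height_le_spanRank_toENat hI.ne_top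
      _ ≤ s.card := by
        rw [← hs]
        simpa using Submodule.spanRank_span_le_card (R := R) (s : Set R)
  · refine le_trans (sInf_le ⟨Finset.univ.image f, rfl, by simpa using hf⟩) (le_trans ?_ hr)
    exact_mod_cast Finset.card_image_le.trans (by simp)

/-- The variables in `T` are mapped as by `φ`, the others are kept as independent variables. -/
def partialEval {σ k B : Type} [Field k] [CommRing B] [Algebra k B]
    (φ : MvPolynomial σ k →ₐ[k] B) (T : Set σ) [DecidablePred (· ∈ T)] :
    MvPolynomial σ k →ₐ[k] MvPolynomial σ B :=
  MvPolynomial.aeval fun i => if i ∈ T then C (φ (X i)) else X i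

theorem ker_partialEval_mono {σ k B : Type} [Field k] [CommRing B] [Algebra k B]
    (φ : MvPolynomial σ k →ₐ[k] B) (T T' : Set σ) [DecidablePred (· ∈ T)]
    [DecidablePred (· ∈ T')] (h : T ⊆ T') :
    RingHom.ker (partialEval φ T) ≤ RingHom.ker (partialEval φ T') := by
  let ψ : MvPolynomial σ B →ₐ[k] MvPolynomial σ B :=
    (MvPolynomial.aeval (R := B) fun i => if i ∈ T' then C (φ (X i)) else X i).restrictScalars k
  have hψ : partialEval φ T' = ψ.comp (partialEval φ T) := by
    ext1 i
    by_cases hi : i ∈ T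
    · simp [partialEval, ψ, hi, h hi, MvPolynomial.algebraMap_eq]
    · simp [partialEval, ψ, hi]
  intro f hf
  rw [RingHom.mem_ker] at hf ⊢
  rw [hψ, AlgHom.comp_apply, hf, map_zero]

theorem ker_partialEval_le {σ k B : Type} [Field k] [CommRing B] [Algebra k B]
    (φ : MvPolynomial σ k →ₐ[k] B) (T : Set σ) [DecidablePred (· ∈ T)] :
    RingHom.ker (partialEval φ T) ≤ RingHom.ker φ := by
  let ψ : MvPolynomial σ B →ₐ[k] B :=
    (MvPolynomial.aeval (R := B) fun i => φ (X i)).restrictScalars k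
  have hψ : φ = ψ.comp (partialEval φ T) := by
    ext1 i
    by_cases hi : i ∈ T
    · simp [partialEval, ψ, hi]
    · simp [partialEval, ψ, hi]
  intro f hf
  rw [RingHom.mem_ker] at hf ⊢
  rw [hψ, AlgHom.comp_apply, hf, map_zero]

/-- If each of the variables `c, …, c + r - 1` satisfies, over the images under `φ` of the
preceding ones, a new polynomial relation, then the kernel of `φ` has height at least `r`. -/
theorem le_height_ker {n c r : ℕ} {k B : Type} [Field k] [CommRing B] [IsDomain B] [Algebra k B]
    (φ : MvPolynomial (Fin n) k →ₐ[k] B) (f : Fin r → MvPolynomial (Fin n) k)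
    (hmem : ∀ j : Fin r, partialEval φ {i | (i : ℕ) < c + j + 1} (f j) = 0)
    (hnot : ∀ j : Fin r, partialEval φ {i | (i : ℕ) < c + j} (f j) ≠ 0) :
    (r : ℕ∞) ≤ (RingHom.ker φ).height := by
  have key : ∀ j : ℕ, j ≤ r →
      (j : ℕ∞) ≤ (RingHom.ker (partialEval φ {i | (i : ℕ) < c + j})).height := by
    intro j
    induction j with
    | zero => simp
    | succ j ih =>
      intro hj
      have hlt : RingHom.ker (partialEval φ {i | (i : ℕ) < c + j}) <
          RingHom.ker (partialEval φ {i | (i : ℕ) < c + (j + 1)}) := by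
        refine lt_of_le_of_ne (ker_partialEval_mono φ _ _ ?_) ?_
        · intro i hi
          simp only [Set.mem_ofPred_eq] at hi ⊢
          omega
        · intro h
          refine hnot ⟨j, hj⟩ ?_
          have := hmem ⟨j, hj⟩
          exact (RingHom.mem_ker).1 (h ▸ (RingHom.mem_ker).2 this)
      have : (RingHom.ker (partialEval φ {i | (i : ℕ) < c + j})).IsPrime := RingHom.ker_isPrime _
      have : (RingHom.ker (partialEval φ {i | (i : ℕ) < c + (j + 1)})).IsPrime :=
        RingHom.ker_isPrime _
      have h1 := Ideal.height_add_one_le_of_lt_of_isPrime hlt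
      push_cast
      exact (add_le_add_left (ih (by omega)) 1).trans h1
  exact (key r le_rfl).trans (Ideal.height_mono (ker_partialEval_le φ _))

/-- If `φ` sends monomials to members of a linearly independent family, then its kernel is
contained in every ideal containing all differences of monomials with equal image. -/
theorem ker_le_of_linearIndependent {σ k B M : Type} [Field k] [CommRing B] [Algebra k B]
    (φ : MvPolynomial σ k →ₐ[k] B) (v : M → B) (hv : LinearIndependent k v)
    (w : (σ →₀ ℕ) → M) (hw : ∀ e, φ (monomial e 1) = v (w e))
    (I : Ideal (MvPolynomial σ k))
    (hI : ∀ e e', w e = w e' →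
      Ideal.Quotient.mk I (monomial e 1) = Ideal.Quotient.mk I (monomial e' 1)) :
    RingHom.ker φ ≤ I := by
  classical
  intro f hf
  rw [RingHom.mem_ker] at hf
  let s : (M →₀ k) →ₗ[k] (MvPolynomial σ k ⧸ I) := Finsupp.linearCombination k fun m =>
    if h : ∃ e, w e = m then Ideal.Quotient.mk I (monomial h.choose 1) else 0
  let W : MvPolynomial σ k →ₗ[k] (M →₀ k) :=
    (MvPolynomial.basisMonomials σ k).constr k fun e => Finsupp.single (w e) 1
  have hWe (e) : W (monomial e 1) = Finsupp.single (w e) 1 := by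
    have := (MvPolynomial.basisMonomials σ k).constr_basis k
      (fun e => (Finsupp.single (w e) 1 : M →₀ k)) e
    simpa [W] using this
  have h1 : φ.toLinearMap = Finsupp.linearCombination k v ∘ₗ W := by
    refine (MvPolynomial.basisMonomials σ k).ext fun e => ?_
    simp [hWe, hw]
  have h2 : (Ideal.Quotient.mkₐ k I).toLinearMap = s ∘ₗ W := by
    refine (MvPolynomial.basisMonomials σ k).ext fun e => ?_
    have hex : ∃ e', w e' = w e := ⟨e, rfl⟩
    simp only [MvPolynomial.coe_basisMonomials, LinearMap.comp_apply, hWe,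
      AlgHom.toLinearMap_apply, Ideal.Quotient.mkₐ_eq_mk, s, Finsupp.linearCombination_single,
      one_smul, dif_pos hex]
    exact hI _ _ hex.choose_spec.symm
  have h3 : W f = 0 := by
    have := LinearMap.congr_fun h1 f
    simp only [AlgHom.toLinearMap_apply, hf, LinearMap.comp_apply] at this
    exact (linearIndependent_iff.1 hv) _ this.symm
  have h4 := LinearMap.congr_fun h2 f
  simp only [LinearMap.comp_apply, h3, map_zero, AlgHom.toLinearMap_apply,
    Ideal.Quotient.mkₐ_eq_mk] at h4
  exact Ideal.Quotient.eq_zero_iff_mem.1 h4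

/-- The weight `Σ e_i a^{r-i} b^i` of an exponent vector. -/
def geomWeight (a b r : ℕ) (e : Fin (r + 1) → ℕ) : ℕ :=
  ∑ i, e i * (a ^ (r - (i : ℕ)) * b ^ (i : ℕ))

theorem geomWeight_succ (a b r : ℕ) (e : Fin (r + 2) → ℕ) :
    geomWeight a b (r + 1) e = e 0 * a ^ (r + 1) + b * geomWeight a b r (fun i => e i.succ) := by
  rw [geomWeight, Fin.sum_univ_succ, geomWeight, Finset.mul_sum]
  simp only [Fin.val_zero, Fin.val_succ, pow_zero, mul_one, Nat.sub_zero]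
  congr 1
  refine Finset.sum_congr rfl fun i _ => ?_
  rw [show r + 1 - ((i : ℕ) + 1) = r - i by omega]
  ring

theorem geomWeight_add (a b r : ℕ) (e e' : Fin (r + 1) → ℕ) :
    geomWeight a b r (e + e') = geomWeight a b r e + geomWeight a b r e' := by
  simp [geomWeight, add_mul, Finset.sum_add_distrib]

theorem geomWeight_single (a b r : ℕ) (i : Fin (r + 1)) (n : ℕ) :
    geomWeight a b r (Pi.single i n) = n * (a ^ (r - (i : ℕ)) * b ^ (i : ℕ)) := by
  rw [geomWeight, Finset.sum_eq_single i] <;> simp +contextual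

/-- Exponent vectors whose entries other than the last are smaller than `b` are determined by
their weight. -/
theorem eq_of_geomWeight_eq {a b : ℕ} (hab : a < b) (hco : Nat.Coprime a b) :
    ∀ (r : ℕ) (e e' : Fin (r + 1) → ℕ), (∀ i : Fin r, e i.castSucc < b) →
      (∀ i : Fin r, e' i.castSucc < b) → geomWeight a b r e = geomWeight a b r e' → e = e' := by
  intro r
  induction r with
  | zero =>
    intro e e' _ _ h
    funext i
    fin_cases i
    simpa [geomWeight] using h
  | succ r ih =>
    intro e e' he he' h
    rw [geomWeight_succ, geomWeight_succ] at h
    have h0 : e 0 = e' 0 := by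
      have hmod : e 0 * a ^ (r + 1) ≡ e' 0 * a ^ (r + 1) [MOD b] := by
        have := congrArg (· % b) h
        simpa [Nat.ModEq] using this
      have := Nat.ModEq.cancel_right_of_coprime
        (by simpa using (Nat.Coprime.pow_left (r + 1) hco).symm) hmod
      exact Nat.ModEq.eq_of_lt_of_lt this (he 0) (he' 0)
    rw [h0] at h
    have h1 := Nat.eq_of_mul_eq_mul_left (by omega) (Nat.add_left_cancel h)
    have h2 := ih _ _ (fun i => by simpa using he i.succ) (fun i => by simpa using he' i.succ) h1
    funext i
    refine Fin.cases h0 (fun i => ?_) i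
    exact congrFun h2 i

/-- Using the relations `x_i^b = y^{b-a} x_{i+1}^a`, every monomial in `y, x_0, …, x_r` can be
rewritten with the exponents of `x_0, …, x_{r-1}` smaller than `b`, without changing its weight
and total degree. -/
theorem exists_reduced_monomial {Q : Type} [CommMonoid Q] {a b r : ℕ} (hab : a < b)
    (y : Q) (x : Fin (r + 1) → Q)
    (hx : ∀ i : Fin r, x i.castSucc ^ b = y ^ (b - a) * x i.succ ^ a) :
    ∀ (n : ℕ) (c : ℕ) (e : Fin (r + 1) → ℕ), ∑ i, e i = n →
      ∃ (c' : ℕ) (e' : Fin (r + 1) → ℕ), (∀ i : Fin r, e' i.castSucc < b) ∧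
        geomWeight a b r e' = geomWeight a b r e ∧ c' + ∑ i, e' i = c + ∑ i, e i ∧
        y ^ c' * ∏ i, x i ^ e' i = y ^ c * ∏ i, x i ^ e i := by
  intro n
  induction n using Nat.strong_induction_on with
  | _ n ih =>
    intro c e hn
    by_cases h : ∀ i : Fin r, e i.castSucc < b
    · exact ⟨c, e, h, rfl, rfl, rfl⟩
    push Not at h
    obtain ⟨i, hi⟩ := h
    obtain ⟨e₀, rfl⟩ : ∃ e₀ : Fin (r + 1) → ℕ, e = e₀ + Pi.single i.castSucc b := by
      refine ⟨e - Pi.single i.castSucc b, ?_⟩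
      funext j
      by_cases hj : j = i.castSucc
      · subst hj; simp [hi]
      · simp [hj]
    have hsum (j : Fin (r + 1)) (m : ℕ) :
        ∑ l, (e₀ + Pi.single j m : Fin (r + 1) → ℕ) l = ∑ l, e₀ l + m := by
      simp [Finset.sum_add_distrib]
    have hprod (j : Fin (r + 1)) (m : ℕ) :
        ∏ l, x l ^ (e₀ + Pi.single j m : Fin (r + 1) → ℕ) l = (∏ l, x l ^ e₀ l) * x j ^ m := by
      simp only [Pi.add_apply, pow_add, Finset.prod_mul_distrib]
      congr 1
      rw [Finset.prod_eq_single j] <;> simp +contextual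
    rw [hsum] at hn
    obtain ⟨c', e', h1, h2, h3, h4⟩ := ih (∑ l, e₀ l + a) (by omega) (c + (b - a))
      (e₀ + Pi.single i.succ a) (hsum _ _)
    refine ⟨c', e', h1, ?_, ?_, ?_⟩
    · rw [h2, geomWeight_add, geomWeight_add, geomWeight_single, geomWeight_single]
      congr 1
      obtain ⟨m, hm⟩ : ∃ m, r - (i : ℕ) = m + 1 := ⟨r - i - 1, by omega⟩
      rw [Fin.val_castSucc, Fin.val_succ, hm, show r - ((i : ℕ) + 1) = m by omega]
      ring
    · rw [h3, hsum, hsum]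
      omega
    · rw [h4, hprod, hprod, hx, pow_add]
      simp only [mul_assoc, mul_comm, mul_left_comm]

/-- Modulo the relations `x_i^b = y^{b-a} x_{i+1}^a`, monomials in `y, x_0, …, x_r` of the same
weight and the same total degree coincide. -/
theorem monomial_eq_of_geomWeight_eq {Q : Type} [CommMonoid Q] {a b r : ℕ} (hab : a < b)
    (hco : Nat.Coprime a b) (y : Q) (x : Fin (r + 1) → Q)
    (hx : ∀ i : Fin r, x i.castSucc ^ b = y ^ (b - a) * x i.succ ^ a)
    (c c' : ℕ) (e e' : Fin (r + 1) → ℕ) (hw : geomWeight a b r e = geomWeight a b r e')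
    (hd : c + ∑ i, e i = c' + ∑ i, e' i) :
    y ^ c * ∏ i, x i ^ e i = y ^ c' * ∏ i, x i ^ e' i := by
  obtain ⟨c₁, e₁, h1, h2, h3, h4⟩ := exists_reduced_monomial hab y x hx _ c e rfl
  obtain ⟨c₂, e₂, g1, g2, g3, g4⟩ := exists_reduced_monomial hab y x hx _ c' e' rfl
  obtain rfl : e₁ = e₂ := eq_of_geomWeight_eq hab hco r _ _ h1 g1 (by rw [h2, g2, hw])
  obtain rfl : c₁ = c₂ := by omega
  rw [← h4, g4]

theorem C_sub_C_mul_X_pow_ne_zero {σ B : Type} [CommRing B] [IsDomain B] (i : σ) {u v : B}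
    (hv : v ≠ 0) {n : ℕ} (hn : 0 < n) :
    (C u - C v * X i ^ n : MvPolynomial σ B) ≠ 0 := by
  classical
  intro h
  have := congrArg (coeff (Finsupp.single i n)) h
  have h0 : (0 : σ →₀ ℕ) ≠ Finsupp.single i n := by
    intro h
    have := congrArg (· i) h
    simp at this
    omega
  simp [coeff_C_mul, coeff_X_pow, coeff_C, h0, hv] at this

end AffineSG

open AffineSG

theorem geomExponent_step {a b r : ℕ} (i : Fin r) :
    b * (a ^ (r - (i.castSucc : ℕ)) * b ^ (i.castSucc : ℕ)) =
      a * (a ^ (r - (i.succ : ℕ)) * b ^ (i.succ : ℕ)) := by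
  obtain ⟨m, hm⟩ : ∃ m, r - (i : ℕ) = m + 1 := ⟨r - i - 1, by omega⟩
  rw [Fin.val_castSucc, Fin.val_succ, hm, show r - ((i : ℕ) + 1) = m by omega]
  ring

theorem geom_relation {R : Type} [CommRing R] (u : R) {a b r : ℕ} (i : Fin r) :
    (u ^ (a ^ (r - (i.castSucc : ℕ)) * b ^ (i.castSucc : ℕ))) ^ b =
      (u ^ (a ^ (r - (i.succ : ℕ)) * b ^ (i.succ : ℕ))) ^ a := by
  rw [← pow_mul, ← pow_mul, mul_comm _ b, geomExponent_step i, mul_comm a]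

theorem geomExponent_le {a b r : ℕ} (hab : a < b) (i : Fin (r + 1)) :
    a ^ (r - (i : ℕ)) * b ^ (i : ℕ) ≤ b ^ r :=
  calc a ^ (r - (i : ℕ)) * b ^ (i : ℕ) ≤ b ^ (r - (i : ℕ)) * b ^ (i : ℕ) :=
        Nat.mul_le_mul_right _ (Nat.pow_le_pow_left hab.le _)
    _ = b ^ r := by rw [← pow_add]; congr 1; omega

theorem geomKer_eq_span {k : Type} [Field k] {a b r : ℕ} (hab : a < b)
    (hco : Nat.Coprime a b) :
    Ideal.span (Set.range (geomP k a b r)) = geomKer k a b r := by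
  refine le_antisymm ?_ ?_
  · rw [Ideal.span_le]
    rintro _ ⟨i, rfl⟩
    simp only [geomKer, geomP, SetLike.mem_coe, RingHom.mem_ker, map_sub, map_pow, aeval_X]
    rw [geom_relation, sub_self]
  · refine ker_le_of_linearIndependent _ (fun n : ℕ => (Polynomial.X : Polynomial k) ^ n) ?_
      (fun e => geomWeight a b r e) ?_ _ ?_
    · have := (Polynomial.basisMonomials k).linearIndependent
      simpa [Polynomial.coe_basisMonomials, Polynomial.monomial_one_right_eq_X_pow] using this
    · intro e
      rw [aeval_monomial, map_one, one_mul, Finsupp.prod_fintype _ _ (by simp), geomWeight,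
        ← Finset.prod_pow_eq_pow_sum]
      exact Finset.prod_congr rfl fun i _ => by rw [← pow_mul, mul_comm]
    · intro e e' h
      set q := Ideal.Quotient.mk (Ideal.span (Set.range (geomP k a b r)))
      have hx (i : Fin r) : q (X i.castSucc) ^ b = 1 ^ (b - a) * q (X i.succ) ^ a := by
        rw [one_pow, one_mul, ← map_pow, ← map_pow, eq_comm, ← sub_eq_zero, ← map_sub]
        exact Ideal.Quotient.eq_zero_iff_mem.2 (Ideal.subset_span ⟨i, rfl⟩)
      have := monomial_eq_of_geomWeight_eq hab hco 1 (fun i => q (X i)) hx (∑ i, e' i) (∑ i, e i)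
        e e' h (add_comm _ _)
      simpa [monomial_eq, Finsupp.prod_fintype] using this

theorem geomKer_le_height {k : Type} [Field k] {a b r : ℕ} (ha : 0 < a) :
    (r : ℕ∞) ≤ (geomKer k a b r).height := by
  refine le_height_ker (c := 1) _ (fun j => X j.castSucc ^ b - X j.succ ^ a) ?_ ?_
  · intro j
    simp only [partialEval, map_sub, map_pow, aeval_X, Set.mem_ofPred_eq, Fin.val_castSucc,
      Fin.val_succ]
    rw [if_pos (by omega), if_pos (by omega), sub_eq_zero]
    have := congrArg (C (σ := Fin (r + 1)))
      (geom_relation (Polynomial.X : Polynomial k) (a := a) (b := b) j)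
    simpa only [map_pow, Fin.val_castSucc, Fin.val_succ] using this
  · intro j
    simp only [partialEval, map_sub, map_pow, aeval_X, Set.mem_ofPred_eq, Fin.val_castSucc,
      Fin.val_succ]
    rw [if_pos (by omega), if_neg (by omega), ← C_pow]
    simpa using C_sub_C_mul_X_pow_ne_zero j.succ (u := ((Polynomial.X : Polynomial k) ^
      (a ^ (r - (j : ℕ)) * b ^ (j : ℕ))) ^ b) one_ne_zero ha

/-- The homogenizations `z_i^b − z_0^{b-a} z_{i+1}^a` of the binomials `P_i` (up to sign). -/
def geomProjP (k : Type) [Field k] (a b r : ℕ) (i : Fin r) : MvPolynomial (Fin (r + 2)) k :=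
  X i.castSucc.succ ^ b - X 0 ^ (b - a) * X i.succ.succ ^ a

theorem geomProj_relation {R : Type} [CommRing R] (u v : R) {a b r : ℕ} (hab : a < b)
    (i : Fin r) :
    (u ^ (a ^ (r - (i.castSucc : ℕ)) * b ^ (i.castSucc : ℕ)) *
        v ^ (b ^ r - a ^ (r - (i.castSucc : ℕ)) * b ^ (i.castSucc : ℕ))) ^ b =
      (v ^ b ^ r) ^ (b - a) * (u ^ (a ^ (r - (i.succ : ℕ)) * b ^ (i.succ : ℕ)) *
        v ^ (b ^ r - a ^ (r - (i.succ : ℕ)) * b ^ (i.succ : ℕ))) ^ a := by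
  have h1 := geomExponent_le (r := r) hab i.castSucc
  have h2 := geomExponent_le (r := r) hab i.succ
  have h3 := geomExponent_step (a := a) (b := b) i
  generalize a ^ (r - (i.castSucc : ℕ)) * b ^ (i.castSucc : ℕ) = s at *
  generalize a ^ (r - (i.succ : ℕ)) * b ^ (i.succ : ℕ) = t at *
  generalize b ^ r = n at *
  obtain ⟨d, rfl⟩ := Nat.exists_eq_add_of_le h1
  obtain ⟨d', hd'⟩ := Nat.exists_eq_add_of_le h2
  obtain ⟨l, rfl⟩ := Nat.exists_eq_add_of_le hab.le
  have h4 : d * (a + l) = (s + d) * l + d' * a := by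
    have : (s + d) * (a + l) = (s + d) * l + (t + d') * a := by rw [← hd']; ring
    nlinarith
  rw [Nat.add_sub_cancel_left, Nat.add_sub_cancel_left,
    show s + d - t = d' by omega, mul_pow, mul_pow, ← pow_mul, ← pow_mul, ← pow_mul, ← pow_mul,
    ← pow_mul, h4, pow_add, mul_comm s, h3, mul_comm t]
  ring

theorem geomProjKer_eq_span {k : Type} [Field k] {a b r : ℕ} (hab : a < b)
    (hco : Nat.Coprime a b) :
    Ideal.span (Set.range (geomProjP k a b r)) = geomProjKer k a b r := by
  refine le_antisymm ?_ ?_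
  · rw [Ideal.span_le]
    rintro _ ⟨i, rfl⟩
    simp only [geomProjKer, geomProjP, SetLike.mem_coe, RingHom.mem_ker, map_sub, map_mul,
      map_pow, aeval_X, Fin.cases_zero, Fin.cases_succ]
    rw [geomProj_relation _ _ hab, sub_self]
  · refine ker_le_of_linearIndependent _
      (fun m : Fin 2 →₀ ℕ => (monomial m 1 : MvPolynomial (Fin 2) k)) ?_
      (fun e => Finsupp.single 0 (geomWeight a b r fun i => e i.succ) +
        Finsupp.single 1 (e 0 * b ^ r + ∑ i : Fin (r + 1),
          e i.succ * (b ^ r - a ^ (r - (i : ℕ)) * b ^ (i : ℕ)))) ?_ _ ?_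
    · simpa using (MvPolynomial.basisMonomials (Fin 2) k).linearIndependent
    · intro e
      rw [aeval_monomial, map_one, one_mul, Finsupp.prod_fintype _ _ (by simp), geomWeight,
        Fin.prod_univ_succ]
      simp only [Fin.cases_zero, Fin.cases_succ, mul_pow, Finset.prod_mul_distrib, ← pow_mul]
      rw [Finset.prod_pow_eq_pow_sum, Finset.prod_pow_eq_pow_sum, ← one_mul (1 : k),
        ← monomial_mul, ← X_pow_eq_monomial, ← X_pow_eq_monomial, pow_add]
      simp only [mul_comm, mul_left_comm]
    · intro e e' h
      have h0 : geomWeight a b r (fun i => e i.succ) = geomWeight a b r (fun i => e' i.succ) := by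
        simpa using congrArg (· 0) h
      have h1 := congrArg (· 1) h
      simp only [Finsupp.add_apply, Finsupp.single_apply] at h1
      simp only [Fin.isValue, zero_ne_one, if_false, if_true, zero_add] at h1
      have hdeg (e : Fin (r + 2) →₀ ℕ) : geomWeight a b r (fun i => e i.succ) +
          (e 0 * b ^ r + ∑ i : Fin (r + 1),
            e i.succ * (b ^ r - a ^ (r - (i : ℕ)) * b ^ (i : ℕ))) =
          (e 0 + ∑ i : Fin (r + 1), e i.succ) * b ^ r := by
        rw [geomWeight, add_left_comm, ← Finset.sum_add_distrib, add_mul, Finset.sum_mul]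
        congr 1
        refine Finset.sum_congr rfl fun i _ => ?_
        rw [← mul_add, Nat.add_sub_cancel' (geomExponent_le hab i)]
      have hd : e 0 + ∑ i : Fin (r + 1), e i.succ = e' 0 + ∑ i : Fin (r + 1), e' i.succ := by
        refine Nat.eq_of_mul_eq_mul_right (pow_pos (by omega : 0 < b) r) ?_
        rw [← hdeg, ← hdeg, h0, h1]
      set q := Ideal.Quotient.mk (Ideal.span (Set.range (geomProjP k a b r)))
      have hx (i : Fin r) : q (X i.castSucc.succ) ^ b =
          q (X 0) ^ (b - a) * q (X i.succ.succ) ^ a := by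
        rw [← map_pow, ← map_pow, ← map_pow, ← map_mul, ← sub_eq_zero, ← map_sub]
        exact Ideal.Quotient.eq_zero_iff_mem.2 (Ideal.subset_span ⟨i, rfl⟩)
      have := monomial_eq_of_geomWeight_eq hab hco (q (X 0)) (fun i => q (X i.succ)) hx (e 0)
        (e' 0) _ _ h0 hd
      simpa [monomial_eq, Finsupp.prod_fintype, Fin.prod_univ_succ] using this

theorem geomProjKer_le_height {k : Type} [Field k] {a b r : ℕ} (ha : 0 < a) (hab : a < b) :
    (r : ℕ∞) ≤ (geomProjKer k a b r).height := by
  refine le_height_ker (c := 2) _ (geomProjP k a b r) ?_ ?_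
  · intro j
    simp only [geomProjP, partialEval, map_sub, map_mul, map_pow, aeval_X, Set.mem_ofPred_eq,
      Fin.val_castSucc, Fin.val_succ, Fin.val_zero, Fin.cases_zero, Fin.cases_succ]
    rw [if_pos (by omega), if_pos (by omega), if_pos (by omega), sub_eq_zero]
    have := congrArg (C (σ := Fin (r + 2)))
      (geomProj_relation (X 0 : MvPolynomial (Fin 2) k) (X 1) hab j)
    simpa only [map_pow, map_mul, Fin.val_castSucc, Fin.val_succ] using this
  · intro j
    simp only [geomProjP, partialEval, map_sub, map_mul, map_pow, aeval_X, Set.mem_ofPred_eq,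
      Fin.val_castSucc, Fin.val_succ, Fin.val_zero, Fin.cases_zero, Fin.cases_succ]
    rw [if_pos (by omega), if_pos (by omega), if_neg (by omega)]
    simp only [← C_pow, ← C_mul]
    exact C_sub_C_mul_X_pow_ne_zero _ (pow_ne_zero _ (pow_ne_zero _ (X_ne_zero _))) ha

open AffineSG MvPolynomial in
/-- For the numerical semigroup minimally generated by the geometric sequence
`a^r, a^{r-1}b, …, b^r` (`gcd(a,b) = 1`, `a < b`), both the semigroup ring `k[S]` and its
projective closure are complete intersections: the height of the defining ideal equals its
minimal number of generators in each case. -/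
theorem geom_complete_intersection {k : Type} [Field k] (a b r : ℕ)
    (ha : 0 < a) (hab : a < b) (hco : Nat.Coprime a b) (hr : 0 < r) :
    IsCompleteIntersectionIdeal (geomKer k a b r) ∧
      IsCompleteIntersectionIdeal (geomProjKer k a b r) := by
  have : (geomKer k a b r).IsPrime := RingHom.ker_isPrime _
  have : (geomProjKer k a b r).IsPrime := RingHom.ker_isPrime _
  exact ⟨isCompleteIntersectionIdeal_of_le_height _ _ (geomKer_eq_span hab hco)
      (geomKer_le_height ha),
    isCompleteIntersectionIdeal_of_le_height _ _ (geomProjKer_eq_span hab hco)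
      (geomProjKer_le_height ha hab)⟩
end
end

section
/- For the numerical semigroup S minimally generated by the geometric sequence a^r, a^{r−1}b, …, b^r (with gcd(a,b) = 1, a < b), the binomials P_1 = z_2^a − z_1^b, …, P_r = z_{r+1}^a − z_r^b form a regular sequence in A = k[z_1,…,z_{r+1}]; consequently the Koszul complex on P_1,…,P_r is a minimal free resolution of A/𝔭 and β_i^A(A/𝔭) = C(r,i) (the binomial coefficient r choose i) for all i. -/
open MvPolynomial CategoryTheory

set_option maxHeartbeats 1000000
set_option synthInstance.maxHeartbeats 400000

noncomputable section

open CategoryTheory in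
/-- A resolution of `M` by finitely generated free modules whose differentials vanish modulo `I`,
with `c n` the rank of the module in degree `n`. -/
structure MinimalFreeResolution {R : Type} [CommRing R] (I : Ideal R) (M : Type)
    [AddCommGroup M] [Module R M] (c : ℕ → ℕ) where
  X : ℕ → ModuleCat.{0} R
  d : ∀ n, X (n + 1) →ₗ[R] X n
  aug : X 0 →ₗ[R] M
  free : ∀ n, Module.Free R (X n)
  finite : ∀ n, Module.Finite R (X n)
  finrank_eq : ∀ n, Module.finrank R (X n) = c n
  exact_succ : ∀ n, Function.Exact (d (n + 1)) (d n)
  exact_zero : Function.Exact (d 0) aug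
  aug_surjective : Function.Surjective aug
  lTensor_d : ∀ n, (d n).lTensor (R ⧸ I) = 0

namespace MinimalFreeResolution

variable {R : Type} [CommRing R] {I : Ideal R} {M : Type} [AddCommGroup M] [Module R M]
  {c : ℕ → ℕ}

/-- The chain complex underlying a resolution. -/
def chainComplex (P : MinimalFreeResolution I M c) : ChainComplex (ModuleCat.{0} R) ℕ :=
  ChainComplex.of P.X (fun n => ModuleCat.ofHom (P.d n)) fun n => by
    ext x
    exact (P.exact_succ n).apply_apply_eq_zero x

lemma chainComplex_d (P : MinimalFreeResolution I M c) (n : ℕ) :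
    P.chainComplex.d (n + 1) n = ModuleCat.ofHom (P.d n) :=
  ChainComplex.of_d P.X (fun n => ModuleCat.ofHom (P.d n)) n

lemma chainComplex_exactAt_succ (P : MinimalFreeResolution I M c) (n : ℕ) :
    P.chainComplex.ExactAt (n + 1) := by
  rw [HomologicalComplex.exactAt_iff' _ (n + 1 + 1) (n + 1) n (by simp) (by simp),
    ShortComplex.ShortExact.moduleCat_exact_iff_function_exact]
  change Function.Exact (P.chainComplex.d (n + 1 + 1) (n + 1)) (P.chainComplex.d (n + 1) n)
  rw [chainComplex_d, chainComplex_d]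
  exact P.exact_succ n

/-- The augmentation, as a morphism of chain complexes. -/
def augmentation (P : MinimalFreeResolution I M c) :
    P.chainComplex ⟶ (ChainComplex.single₀ _).obj (ModuleCat.of R M) :=
  (ChainComplex.toSingle₀Equiv _ _).symm ⟨ModuleCat.ofHom P.aug, by
    rw [chainComplex_d]
    ext x
    exact P.exact_zero.apply_apply_eq_zero x⟩

lemma augmentation_f_zero (P : MinimalFreeResolution I M c) :
    P.augmentation.f 0 = ModuleCat.ofHom P.aug :=
  ChainComplex.toSingle₀Equiv_symm_apply_f_zero _ _

lemma quasiIso_augmentation (P : MinimalFreeResolution I M c) : QuasiIso P.augmentation :=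
  ⟨fun n => by
    cases n with
    | zero =>
      rw [ChainComplex.quasiIsoAt₀_iff, ShortComplex.quasiIso_iff_of_zeros']
      · constructor
        · rw [ShortComplex.ShortExact.moduleCat_exact_iff_function_exact]
          change Function.Exact (P.chainComplex.d 1 0) (P.augmentation.f 0)
          rw [chainComplex_d, augmentation_f_zero]
          exact P.exact_zero
        · change Epi (P.augmentation.f 0)
          rw [augmentation_f_zero]
          exact (ModuleCat.epi_iff_surjective (ModuleCat.ofHom P.aug)).2 P.aug_surjective
      all_goals rfl
    | succ n =>
      rw [quasiIsoAt_iff_exactAt']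
      · exact P.chainComplex_exactAt_succ n
      · apply ChainComplex.exactAt_succ_single_obj⟩

/-- The associated projective resolution. -/
def projectiveResolution (P : MinimalFreeResolution I M c) :
    ProjectiveResolution (ModuleCat.of R M) where
  complex := P.chainComplex
  projective n := by
    have := P.free n
    change Projective (P.X n)
    exact (IsProjective.iff_projective (R := R) (P.X n)).1 Module.Projective.of_free
  π := P.augmentation
  quasiIso := P.quasiIso_augmentation

open MonoidalCategory in
lemma tensor_d_eq_zero (P : MinimalFreeResolution I M c) (i j : ℕ) :
    (((((tensoringLeft (ModuleCat R)).obj (ModuleCat.of R (R ⧸ I))).mapHomologicalComplex _).obj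
      P.chainComplex).d i j) = 0 := by
  by_cases h : j + 1 = i
  · subst h
    change (ModuleCat.of R (R ⧸ I)) ◁ P.chainComplex.d (j + 1) j = 0
    rw [chainComplex_d]
    have := P.lTensor_d j
    ext x
    exact LinearMap.congr_fun this x
  · exact HomologicalComplex.shape _ _ _ h

open MonoidalCategory in
/-- The Tor modules of `R ⧸ I` and `M` are the reductions of the terms of the resolution. -/
def torIso (P : MinimalFreeResolution I M c) (n : ℕ) :
    ((Tor (ModuleCat R) n).obj (ModuleCat.of R (R ⧸ I))).obj (ModuleCat.of R M) ≅
      ModuleCat.of R (R ⧸ I) ⊗ P.X n :=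
  P.projectiveResolution.isoLeftDerivedObj
      ((tensoringLeft (ModuleCat R)).obj (ModuleCat.of R (R ⧸ I))) n ≪≫
    (ShortComplex.HomologyData.ofZeros
      (((((tensoringLeft (ModuleCat R)).obj (ModuleCat.of R (R ⧸ I))).mapHomologicalComplex _).obj
        P.chainComplex).sc n) (P.tensor_d_eq_zero _ _) (P.tensor_d_eq_zero _ _)).left.homologyIso

lemma length_tor [I.IsMaximal] (P : MinimalFreeResolution I M c) (n : ℕ) :
    Module.length R
      (((Tor (ModuleCat R) n).obj (ModuleCat.of R (R ⧸ I))).obj (ModuleCat.of R M)) = c n := by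
  rw [(P.torIso n).toLinearEquiv.length_eq]
  have := P.free n
  have := P.finite n
  change Module.length R (TensorProduct R (R ⧸ I) (P.X n)) = c n
  have hsurj : Function.Surjective (algebraMap R (R ⧸ I)) := Ideal.Quotient.mk_surjective
  let _ := Ideal.Quotient.field I
  have : Nontrivial R := hsurj.nontrivial
  rw [Module.length_eq_of_surjective (R := R ⧸ I) hsurj]
  rw [Module.length_eq_finrank, Module.finrank_baseChange, P.finrank_eq]

lemma bettiNumber_eq [I.IsMaximal] (P : MinimalFreeResolution I M c) (n : ℕ) :
    AffineSG.bettiNumber R I M n = (c n : WithBot ℕ∞) := by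
  rw [AffineSG.bettiNumber, AffineSG.moduleLength, ← Module.coe_length, P.length_tor]
  rfl

/-- Transport of a resolution along a linear equivalence. -/
def congr {N : Type} [AddCommGroup N] [Module R N] (P : MinimalFreeResolution I M c)
    (e : M ≃ₗ[R] N) : MinimalFreeResolution I N c :=
  { P with
    aug := e.toLinearMap ∘ₗ P.aug
    aug_surjective := e.surjective.comp P.aug_surjective
    exact_zero := fun x => by
      rw [← P.exact_zero x]
      simp }

/-- The terms of the resolution of the ring by itself. -/
def selfX (R : Type) [CommRing R] : ℕ → ModuleCat.{0} R
  | 0 => ModuleCat.of R R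
  | _ + 1 => ModuleCat.of R PUnit

/-- The ring is its own resolution. -/
def self (I : Ideal R) [Nontrivial R] :
    MinimalFreeResolution I R (Nat.choose 0) where
  X := selfX R
  d _ := 0
  aug := LinearMap.id
  free
    | 0 => inferInstanceAs (Module.Free R R)
    | _ + 1 => inferInstanceAs (Module.Free R PUnit)
  finite
    | 0 => inferInstanceAs (Module.Finite R R)
    | _ + 1 => inferInstanceAs (Module.Finite R PUnit)
  finrank_eq
    | 0 => Module.finrank_self R
    | _ + 1 => Module.finrank_zero_of_subsingleton (R := R) (M := PUnit)
  exact_succ _ := fun _ => ⟨fun _ => ⟨0, Subsingleton.elim (α := PUnit) _ _⟩, fun _ => rfl⟩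
  exact_zero := fun _ => ⟨fun h => ⟨0, h.symm⟩, fun ⟨_, h⟩ => h.symm⟩
  aug_surjective := Function.surjective_id
  lTensor_d _ := LinearMap.lTensor_zero _

/-- The terms of the mapping cone of multiplication by a ring element. -/
def coneX (X : ℕ → ModuleCat.{0} R) : ℕ → ModuleCat.{0} R
  | 0 => X 0
  | n + 1 => ModuleCat.of R (X (n + 1) × X n)

/-- The differentials of the mapping cone of multiplication by `x`. -/
def coneD (P : MinimalFreeResolution I M c) (x : R) :
    ∀ n, coneX P.X (n + 1) →ₗ[R] coneX P.X n
  | 0 => (P.d 0).coprod (x • LinearMap.id)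
  | n + 1 => LinearMap.prod ((P.d (n + 1)).coprod (x • LinearMap.id))
      (-(P.d n ∘ₗ LinearMap.snd R (P.X (n + 2)) (P.X (n + 1))))

lemma exists_of_d_add_smul_eq_zero (P : MinimalFreeResolution I M c) (x : R) (n : ℕ)
    (p : P.X (n + 1)) (q : P.X n) (q' : P.X (n + 1)) (h : P.d n p + x • q = 0)
    (hq : P.d n q' = q) :
    ∃ y : P.X (n + 2) × P.X (n + 1), P.d (n + 1) y.1 + x • y.2 = p ∧ -P.d n y.2 = q := by
  obtain ⟨p', hp'⟩ := (P.exact_succ n (p + x • q')).1 (by rw [map_add, map_smul, hq, h])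
  exact ⟨(p', -q'), by simp [hp'], by simp [hq]⟩

lemma coneD_exact_succ (P : MinimalFreeResolution I M c) {x : R} (hx : IsSMulRegular M x) :
    ∀ n, Function.Exact (P.coneD x (n + 1)) (P.coneD x n)
  | 0 => by
    rintro ⟨p, q⟩
    constructor
    · intro h
      replace h : P.d 0 p + x • q = 0 := h
      have hq : P.aug q = 0 := by
        apply hx
        have := congrArg P.aug h
        simpa [P.exact_zero.apply_apply_eq_zero] using this
      obtain ⟨q', hq'⟩ := (P.exact_zero q).1 hq
      obtain ⟨y, h₁, h₂⟩ := P.exists_of_d_add_smul_eq_zero x 0 p q q' h hq'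
      exact ⟨y, Prod.ext h₁ h₂⟩
    · rintro ⟨⟨p', q'⟩, h⟩
      have h₁ : P.d 1 p' + x • q' = p := congrArg Prod.fst h
      have h₂ : -P.d 0 q' = q := congrArg Prod.snd h
      change P.d 0 p + x • q = 0
      rw [← h₁, ← h₂]
      simp [(P.exact_succ 0).apply_apply_eq_zero]
  | n + 1 => by
    rintro ⟨p, q⟩
    constructor
    · intro h
      have h₁ : P.d (n + 1) p + x • q = 0 := congrArg Prod.fst h
      have h₂ : P.d n q = 0 := neg_eq_zero.1 (congrArg Prod.snd h)
      obtain ⟨q', hq'⟩ := (P.exact_succ n q).1 h₂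
      obtain ⟨y, h₁, h₂⟩ := P.exists_of_d_add_smul_eq_zero x (n + 1) p q q' h₁ hq'
      exact ⟨y, Prod.ext h₁ h₂⟩
    · rintro ⟨⟨p', q'⟩, h⟩
      have h₁ : P.d (n + 2) p' + x • q' = p := congrArg Prod.fst h
      have h₂ : -P.d (n + 1) q' = q := congrArg Prod.snd h
      refine Prod.ext (?_ : P.d (n + 1) p + x • q = 0) (?_ : -P.d n q = 0)
      · rw [← h₁, ← h₂]
        simp [(P.exact_succ (n + 1)).apply_apply_eq_zero]
      · rw [← h₂]
        simp [(P.exact_succ n).apply_apply_eq_zero]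

lemma lTensor_smul_eq_zero {N N' : Type} [AddCommGroup N] [Module R N] [AddCommGroup N']
    [Module R N'] {x : R} (hx : x ∈ I) (f : N →ₗ[R] N') :
    (x • f).lTensor (R ⧸ I) = 0 := by
  have h (y : R ⧸ I) : x • y = 0 := by
    rw [Algebra.smul_def]
    exact mul_eq_zero_of_left (Ideal.Quotient.eq_zero_iff_mem.2 hx) y
  rw [LinearMap.lTensor_smul]
  refine TensorProduct.ext' fun y z => ?_
  rw [LinearMap.smul_apply, LinearMap.lTensor_tmul, TensorProduct.smul_tmul', h,
    TensorProduct.zero_tmul, LinearMap.zero_apply]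

lemma lTensor_coprod_smul_eq_zero {N₁ N₂ N : Type} [AddCommGroup N₁] [Module R N₁]
    [AddCommGroup N₂] [Module R N₂] [AddCommGroup N] [Module R N] {x : R} (hx : x ∈ I)
    {f : N₁ →ₗ[R] N} (hf : f.lTensor (R ⧸ I) = 0) (g : N₂ →ₗ[R] N) :
    (f.coprod (x • g)).lTensor (R ⧸ I) = 0 := by
  have : f.coprod (x • g) =
      f ∘ₗ LinearMap.fst R N₁ N₂ + x • (g ∘ₗ LinearMap.snd R N₁ N₂) := rfl
  rw [this, LinearMap.lTensor_add, LinearMap.lTensor_comp, hf, lTensor_smul_eq_zero hx,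
    LinearMap.zero_comp, add_zero]

lemma lTensor_neg_comp_eq_zero {N₁ N₂ N : Type} [AddCommGroup N₁] [Module R N₁]
    [AddCommGroup N₂] [Module R N₂] [AddCommGroup N] [Module R N]
    {f : N₁ →ₗ[R] N₂} (hf : f.lTensor (R ⧸ I) = 0) (g : N →ₗ[R] N₁) :
    (-(f ∘ₗ g)).lTensor (R ⧸ I) = 0 := by
  rw [← LinearMap.comp_neg, LinearMap.lTensor_comp, hf, LinearMap.zero_comp]

lemma lTensor_prod_eq_zero {N₁ N₂ N : Type} [AddCommGroup N₁] [Module R N₁]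
    [AddCommGroup N₂] [Module R N₂] [AddCommGroup N] [Module R N]
    {f : N →ₗ[R] N₁} (hf : f.lTensor (R ⧸ I) = 0) {g : N →ₗ[R] N₂}
    (hg : g.lTensor (R ⧸ I) = 0) :
    (f.prod g).lTensor (R ⧸ I) = 0 := by
  have : f.prod g = LinearMap.inl R N₁ N₂ ∘ₗ f + LinearMap.inr R N₁ N₂ ∘ₗ g := by
    ext y <;> simp
  rw [this, LinearMap.lTensor_add, LinearMap.lTensor_comp, LinearMap.lTensor_comp, hf, hg,
    LinearMap.comp_zero, LinearMap.comp_zero, add_zero]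

lemma lTensor_coneD (P : MinimalFreeResolution I M c) {x : R} (hx : x ∈ I) :
    ∀ n, (P.coneD x n).lTensor (R ⧸ I) = 0
  | 0 => lTensor_coprod_smul_eq_zero hx (P.lTensor_d 0) _
  | n + 1 => lTensor_prod_eq_zero (lTensor_coprod_smul_eq_zero hx (P.lTensor_d (n + 1)) _)
      (lTensor_neg_comp_eq_zero (P.lTensor_d n) _)

/-- The mapping cone of multiplication by a regular element `x` resolves `M ⧸ x M`. -/
def cone [Nontrivial R] {j : ℕ} (P : MinimalFreeResolution I M j.choose) {x : R} (hx : x ∈ I)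
    (hreg : IsSMulRegular M x) :
    MinimalFreeResolution I (QuotSMulTop x M) (j + 1).choose where
  X := coneX P.X
  d := P.coneD x
  aug := Submodule.mkQ _ ∘ₗ P.aug
  free
    | 0 => P.free 0
    | n + 1 => by
      have := P.free n
      have := P.free (n + 1)
      exact inferInstanceAs (Module.Free R (P.X (n + 1) × P.X n))
  finite
    | 0 => P.finite 0
    | n + 1 => by
      have := P.finite n
      have := P.finite (n + 1)
      exact inferInstanceAs (Module.Finite R (P.X (n + 1) × P.X n))
  finrank_eq
    | 0 => (P.finrank_eq 0).trans (by simp)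
    | n + 1 => by
      have := P.finite n
      have := P.finite (n + 1)
      have := P.free n
      have := P.free (n + 1)
      refine (Module.finrank_prod (R := R) (M := P.X (n + 1)) (M' := P.X n)).trans ?_
      rw [P.finrank_eq, P.finrank_eq, Nat.choose_succ_succ, add_comm]
  exact_succ := P.coneD_exact_succ hreg
  exact_zero := by
    intro (p : P.X 0)
    change Submodule.Quotient.mk (P.aug p) = (0 : QuotSMulTop x M) ↔ _
    rw [Submodule.Quotient.mk_eq_zero, Submodule.mem_smul_pointwise_iff_exists]
    constructor
    · rintro ⟨m, -, hm⟩
      obtain ⟨q, rfl⟩ := P.aug_surjective m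
      obtain ⟨p', hp'⟩ := (P.exact_zero (p - x • q)).1 (by
        rw [map_sub, map_smul, sub_eq_zero]
        exact hm.symm)
      refine ⟨(p', q), ?_⟩
      change P.d 0 p' + x • q = p
      rw [hp', sub_add_cancel]
    · rintro ⟨⟨p', q⟩, rfl⟩
      refine ⟨P.aug q, trivial, ?_⟩
      change _ = P.aug (P.d 0 p' + x • q)
      simp [P.exact_zero.apply_apply_eq_zero]
  aug_surjective := (Submodule.mkQ_surjective _).comp P.aug_surjective
  lTensor_d := P.lTensor_coneD hx

end MinimalFreeResolution

open RingTheory.Sequence in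
/-- Killing a regular sequence of length `s` in `I` turns a module with a minimal resolution with
ranks `j.choose` into one with ranks `(j + s).choose`. -/
lemma MinimalFreeResolution.nonempty_of_isWeaklyRegular {R : Type} [CommRing R] [Nontrivial R]
    {I : Ideal R} (rs : List R) (hI : ∀ x ∈ rs, x ∈ I) :
    ∀ (M : Type) [AddCommGroup M] [Module R M] (j : ℕ), MinimalFreeResolution I M j.choose →
      IsWeaklyRegular M rs →
      Nonempty (MinimalFreeResolution I (M ⧸ (Ideal.ofList rs • ⊤ : Submodule R M))
        (j + rs.length).choose) := by
  induction rs with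
  | nil =>
    intro M _ _ j P _
    refine ⟨P.congr (Submodule.quotEquivOfEqBot _ ?_).symm⟩
    rw [Ideal.ofList_nil, Submodule.bot_smul]
  | cons x rs ih =>
    intro M _ _ j P h
    rw [isWeaklyRegular_cons_iff] at h
    obtain ⟨Q⟩ := ih (fun y hy => hI y (List.mem_cons_of_mem _ hy)) _ (j + 1)
      (P.cone (hI x List.mem_cons_self) h.1) h.2
    rw [List.length_cons, add_comm rs.length, ← add_assoc]
    exact ⟨Q.congr (Submodule.quotOfListConsSMulTopEquivQuotSMulTopInner M x rs).symm⟩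

section GeometricSequence

variable {k : Type} [Field k] {a b r : ℕ}

/-- Modulo elements of `k[z_j : j ≠ i]`, a power of `z_i` minus an element of `k[z_j : j ≠ i]` is
a nonzerodivisor. -/
lemma mem_span_of_monic_mul_mem {σ : Type} [DecidableEq σ] (i : σ)
    (s : Set (MvPolynomial σ k)) (t : Set (MvPolynomial {j // j ≠ i} k))
    (hs : s = MvPolynomial.rename (↑) '' t)
    (q : MvPolynomial {j // j ≠ i} k) {n : ℕ} (hn : n ≠ 0) (f : MvPolynomial σ k)
    (h : (MvPolynomial.X i ^ n - MvPolynomial.rename (↑) q) * f ∈ Ideal.span s) :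
    f ∈ Ideal.span s := by
  let e : MvPolynomial σ k ≃ₐ[k] Polynomial (MvPolynomial {j // j ≠ i} k) :=
    (MvPolynomial.renameEquiv k (Equiv.optionSubtypeNe i).symm).trans
      (MvPolynomial.optionEquivLeft k {j // j ≠ i})
  have heX : e (MvPolynomial.X i) = Polynomial.X := by
    simp [e]
  have heC (p : MvPolynomial {j // j ≠ i} k) :
      e (MvPolynomial.rename (↑) p) = Polynomial.C p := by
    have : (e : MvPolynomial σ k →ₐ[k] _).comp (MvPolynomial.rename (↑)) =
        IsScalarTower.toAlgHom k (MvPolynomial {j // j ≠ i} k)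
          (Polynomial (MvPolynomial {j // j ≠ i} k)) := by
      ext j : 1
      simp [e, Equiv.optionSubtypeNe_symm_of_ne j.2]
    exact DFunLike.congr_fun this p
  let Ψ : MvPolynomial σ k →+* Polynomial (MvPolynomial {j // j ≠ i} k ⧸ Ideal.span t) :=
    (Polynomial.mapRingHom (Ideal.Quotient.mk (Ideal.span t))).comp (e : _ →+* _)
  have hker : RingHom.ker Ψ = Ideal.span s := by
    have hmap : Ideal.map (e : _ →+* _) (Ideal.span s) =
        RingHom.ker (Polynomial.mapRingHom (Ideal.Quotient.mk (Ideal.span t))) := by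
      rw [Polynomial.ker_mapRingHom, Ideal.mk_ker, Ideal.map_span, Ideal.map_span, hs,
        Set.image_image]
      congr 1
      exact Set.image_congr fun p _ => heC p
    rw [← RingHom.comap_ker, ← hmap]
    exact Ideal.comap_map_of_bijective _ e.bijective
  rw [← hker, RingHom.mem_ker] at h ⊢
  rw [map_mul] at h
  have hΨ : Ψ (MvPolynomial.X i ^ n - MvPolynomial.rename (↑) q) =
      Polynomial.X ^ n - Polynomial.C (Ideal.Quotient.mk (Ideal.span t) q) := by
    change Polynomial.map _ (e _) = _
    rw [map_sub, map_pow, heX, heC]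
    simp
  rw [hΨ] at h
  exact (Polynomial.monic_X_pow_sub_C _ hn).isRegular.left (by simpa using h)

lemma ofList_ofFn_geomP :
    Ideal.ofList (List.ofFn (geomP k a b r)) = Ideal.span (Set.range (geomP k a b r)) := by
  refine congrArg Ideal.span (Set.ext fun x => ?_)
  simp

lemma isWeaklyRegular_geomP (ha : 0 < a) :
    RingTheory.Sequence.IsWeaklyRegular (MvPolynomial (Fin (r + 1)) k)
      (List.ofFn (geomP k a b r)) := by
  constructor
  intro i hi
  have hir : i < r := by simpa using hi
  rw [List.getElem_ofFn]
  set L := (List.ofFn (geomP k a b r)).take i with hL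
  have hsmul : (Ideal.ofList L • ⊤ : Submodule _ (MvPolynomial (Fin (r + 1)) k)) =
      Ideal.ofList L := by
    rw [smul_eq_mul, Ideal.mul_top]
  rw [hsmul, isSMulRegular_iff_right_eq_zero_of_smul]
  intro f
  obtain ⟨f, rfl⟩ := Ideal.Quotient.mk_surjective f
  intro h
  have hmem : geomP k a b r ⟨i, hir⟩ * f ∈ Ideal.ofList L :=
    Ideal.Quotient.eq_zero_iff_mem.1 h
  refine Ideal.Quotient.eq_zero_iff_mem.2 ?_
  have hlast (j : Fin i) : (⟨j, by omega⟩ : Fin (r + 1)) ≠ (⟨i, hir⟩ : Fin r).succ := by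
    simp [Fin.ext_iff]; omega
  have hlast' (j : Fin i) : (⟨j + 1, by omega⟩ : Fin (r + 1)) ≠ (⟨i, hir⟩ : Fin r).succ := by
    simp [Fin.ext_iff]; omega
  refine mem_span_of_monic_mul_mem (⟨i, hir⟩ : Fin r).succ {x | x ∈ L}
    (Set.range fun j : Fin i =>
      MvPolynomial.X ⟨_, hlast' j⟩ ^ a - MvPolynomial.X ⟨_, hlast j⟩ ^ b) ?_
    (MvPolynomial.X ⟨(⟨i, hir⟩ : Fin r).castSucc, by simp [Fin.ext_iff]⟩ ^ b) ha.ne' f ?_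
  · ext x
    simp only [hL, Set.mem_ofPred_eq, List.mem_take_iff_getElem, Set.mem_image, Set.mem_range,
      exists_exists_eq_and, map_sub, map_pow, MvPolynomial.rename_X, List.getElem_ofFn]
    constructor
    · rintro ⟨j, hj, rfl⟩
      exact ⟨⟨j, by omega⟩, rfl⟩
    · rintro ⟨j, rfl⟩
      exact ⟨j, by simp; omega, rfl⟩
  · simpa [geomP] using hmem

lemma isRegular_geomP (ha : 0 < a) (hb : 0 < b) :
    RingTheory.Sequence.IsRegular (MvPolynomial (Fin (r + 1)) k)
      (List.ofFn (geomP k a b r)) := by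
  refine ⟨isWeaklyRegular_geomP ha, fun h => ?_⟩
  rw [smul_eq_mul, Ideal.mul_top, ofList_ofFn_geomP] at h
  have hle : Ideal.span (Set.range (geomP k a b r)) ≤
      RingHom.ker (MvPolynomial.constantCoeff (σ := Fin (r + 1)) (R := k)) := by
    rw [Ideal.span_le]
    rintro _ ⟨i, rfl⟩
    simp [geomP, ha.ne', hb.ne']
  have : (1 : MvPolynomial (Fin (r + 1)) k) ∈
      RingHom.ker (MvPolynomial.constantCoeff (σ := Fin (r + 1)) (R := k)) :=
    hle (h ▸ Submodule.mem_top)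
  simp at this

/-- The degree of the monomial with exponent vector `u` when `z_i` has degree `m_i`. -/
def geomWeight (a b r : ℕ) (u : Fin (r + 1) → ℕ) : ℕ :=
  ∑ i : Fin (r + 1), a ^ (r - (i : ℕ)) * b ^ (i : ℕ) * u i

lemma geomWeight_succ (u : Fin (r + 2) → ℕ) :
    geomWeight a b (r + 1) u =
      a * geomWeight a b r (fun i => u i.castSucc) + b ^ (r + 1) * u (Fin.last _) := by
  simp only [geomWeight]
  rw [Fin.sum_univ_castSucc, Finset.mul_sum]
  congr 1
  · refine Finset.sum_congr rfl fun i _ => ?_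
    have : r + 1 - (i : ℕ) = r - i + 1 := by omega
    rw [Fin.val_castSucc, this, pow_succ]
    ring
  · simp

lemma geomWeight_injOn (ha : 0 < a) (hco : Nat.Coprime a b) :
    ∀ {r : ℕ} {u v : Fin (r + 1) → ℕ}, (∀ i : Fin r, u i.succ < a) →
      (∀ i : Fin r, v i.succ < a) → geomWeight a b r u = geomWeight a b r v → u = v
  | 0, u, v, _, _, h => by
    ext i
    rw [Fin.fin_one_eq_zero i]
    simpa [geomWeight] using h
  | r + 1, u, v, hu, hv, h => by
    rw [geomWeight_succ, geomWeight_succ] at h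
    have hlast : u (Fin.last _) = v (Fin.last _) := by
      have hmod : b ^ (r + 1) * u (Fin.last _) ≡ b ^ (r + 1) * v (Fin.last _) [MOD a] := by
        have := congrArg (· % a) h
        simpa [Nat.ModEq, Nat.add_mod] using this
      have := Nat.ModEq.cancel_left_of_coprime (by simpa using hco.pow_right (r + 1)) hmod
      exact this.eq_of_lt_of_lt (hu (Fin.last r)) (hv (Fin.last r))
    rw [hlast, Nat.add_right_cancel_iff, Nat.mul_right_inj ha.ne'] at h
    have ih := geomWeight_injOn ha hco (fun i => hu i.castSucc) (fun i => hv i.castSucc) h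
    ext i
    exact Fin.lastCases hlast (fun j => congrFun ih j) i

/-- The map `z_i ↦ t^{m_i}`. -/
def geomMap (k : Type) [Field k] (a b r : ℕ) :
    MvPolynomial (Fin (r + 1)) k →ₐ[k] Polynomial k :=
  MvPolynomial.aeval fun i : Fin (r + 1) =>
    (Polynomial.X : Polynomial k) ^ (a ^ (r - (i : ℕ)) * b ^ (i : ℕ))

lemma geomMap_monomial (u : Fin (r + 1) →₀ ℕ) :
    geomMap k a b r (MvPolynomial.monomial u 1) = Polynomial.X ^ geomWeight a b r u := by
  rw [geomMap, MvPolynomial.aeval_monomial, map_one, one_mul,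
    Finsupp.prod_fintype _ _ fun i => pow_zero _, geomWeight, ← Finset.prod_pow_eq_pow_sum]
  simp only [pow_mul]

lemma span_geomP_le_ker : Ideal.span (Set.range (geomP k a b r)) ≤ geomKer k a b r := by
  rw [Ideal.span_le]
  rintro _ ⟨i, rfl⟩
  have hi : r - (i : ℕ) = r - (i + 1) + 1 := by omega
  simp only [SetLike.mem_coe, geomKer, RingHom.mem_ker, geomP, map_sub, map_pow,
    MvPolynomial.aeval_X, ← pow_mul, Fin.val_succ, Fin.val_castSucc, hi]
  rw [sub_eq_zero]
  congr 1
  ring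

/-- Every monomial is congruent modulo the binomials `P_i` to one in which all variables but the
first have exponent less than `a`. -/
lemma exists_reduced_monomial (ha : 0 < a) (u : Fin (r + 1) →₀ ℕ) :
    ∃ v : Fin (r + 1) →₀ ℕ, (∀ i : Fin r, v i.succ < a) ∧
      MvPolynomial.monomial u (1 : k) - MvPolynomial.monomial v 1 ∈
        Ideal.span (Set.range (geomP k a b r)) := by
  induction hn : Finsupp.linearCombination ℕ (fun i : Fin (r + 1) => (b + 1) ^ (i : ℕ)) u
    using Nat.strong_induction_on generalizing u with
  | _ n ih =>
    by_cases hu : ∀ i : Fin r, u i.succ < a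
    · exact ⟨u, hu, by simp⟩
    push Not at hu
    obtain ⟨i, hi⟩ := hu
    obtain ⟨u', rfl⟩ : ∃ u', u = u' + Finsupp.single i.succ a :=
      ⟨u - Finsupp.single i.succ a, (tsub_add_cancel_of_le (by simpa using hi)).symm⟩
    obtain ⟨v, hv, hmem⟩ := ih _ (by
      simp only [← hn, map_add, Finsupp.linearCombination_single, smul_eq_mul, Fin.val_castSucc,
        Fin.val_succ, pow_succ]
      have hpos : 0 < (b + 1) ^ (i : ℕ) := by positivity
      have : b < a * (b + 1) := by nlinarith
      nlinarith) (u' + Finsupp.single i.castSucc b) rfl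
    refine ⟨v, hv, ?_⟩
    rw [← sub_add_sub_cancel _ (MvPolynomial.monomial (u' + Finsupp.single i.castSucc b) (1 : k))]
    refine add_mem ?_ hmem
    have : MvPolynomial.monomial (u' + Finsupp.single i.succ a) (1 : k) -
        MvPolynomial.monomial (u' + Finsupp.single i.castSucc b) 1 =
        MvPolynomial.monomial u' 1 * geomP k a b r i := by
      simp [geomP, MvPolynomial.X_pow_eq_monomial, mul_sub, MvPolynomial.monomial_mul]
    rw [this]
    exact Ideal.mul_mem_left _ _ (Ideal.subset_span ⟨i, rfl⟩)

lemma span_geomP_eq_geomKer (ha : 0 < a) (hco : Nat.Coprime a b) :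
    Ideal.span (Set.range (geomP k a b r)) = geomKer k a b r := by
  classical
  refine le_antisymm span_geomP_le_ker ?_
  choose N hN hmem using exists_reduced_monomial (k := k) (r := r) (b := b) ha
  have hweight (u : Fin (r + 1) →₀ ℕ) : geomWeight a b r (N u) = geomWeight a b r u := by
    have h : geomMap k a b r _ = 0 := span_geomP_le_ker (hmem u)
    rw [map_sub, geomMap_monomial, geomMap_monomial, sub_eq_zero] at h
    simpa using (congrArg Polynomial.natDegree h).symm
  have hNeq {u v : Fin (r + 1) →₀ ℕ} (h : geomWeight a b r u = geomWeight a b r v) :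
      N u = N v :=
    DFunLike.coe_injective <|
      geomWeight_injOn ha hco (hN u) (hN v) (by rw [hweight, hweight, h])
  let σ : Polynomial k →ₗ[k] MvPolynomial (Fin (r + 1)) k :=
    (Polynomial.basisMonomials k).constr k fun n =>
      if h : ∃ u : Fin (r + 1) →₀ ℕ, geomWeight a b r u = n then
        MvPolynomial.monomial (N h.choose) 1 else 0
  have hσ (u : Fin (r + 1) →₀ ℕ) :
      σ (geomMap k a b r (MvPolynomial.monomial u 1)) = MvPolynomial.monomial (N u) 1 := by
    have h : ∃ v : Fin (r + 1) →₀ ℕ, geomWeight a b r v = geomWeight a b r u := ⟨u, rfl⟩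
    have hX : (Polynomial.X : Polynomial k) ^ geomWeight a b r u =
        Polynomial.basisMonomials k (geomWeight a b r u) := by
      simp [Polynomial.X_pow_eq_monomial]
    rw [geomMap_monomial, hX, Module.Basis.constr_basis, dif_pos h, hNeq h.choose_spec]
  have hsub (f : MvPolynomial (Fin (r + 1)) k) :
      f - σ (geomMap k a b r f) ∈ Ideal.span (Set.range (geomP k a b r)) := by
    induction f using MvPolynomial.induction_on' with
    | monomial u c =>
      have hc : MvPolynomial.monomial u c = c • MvPolynomial.monomial u (1 : k) := by
        simp [MvPolynomial.smul_monomial]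
      rw [hc, map_smul, map_smul, hσ, ← smul_sub]
      exact Submodule.smul_of_tower_mem _ c (hmem u)
    | add p q hp hq =>
      rw [map_add, map_add, add_sub_add_comm]
      exact add_mem hp hq
  intro f hf
  have hf : geomMap k a b r f = 0 := hf
  simpa [hf] using hsub f

/-- The ideal generated by the variables of a polynomial ring over a field is maximal. -/
lemma isMaximal_span_range_X {σ : Type} :
    (Ideal.span (Set.range (MvPolynomial.X : σ → MvPolynomial σ k))).IsMaximal := by
  have : Ideal.span (Set.range (MvPolynomial.X : σ → MvPolynomial σ k)) =
      RingHom.ker (MvPolynomial.constantCoeff (σ := σ) (R := k)) := by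
    ext p
    rw [← Set.image_univ, MvPolynomial.mem_ideal_span_X_image, RingHom.mem_ker]
    simp only [Set.mem_univ, true_and, MvPolynomial.constantCoeff_eq]
    refine ⟨fun h => ?_, fun h m hm => ?_⟩
    · by_contra h0
      obtain ⟨i, hi⟩ := h 0 (MvPolynomial.mem_support_iff.2 h0)
      exact hi rfl
    · by_contra! hm0
      obtain rfl : m = 0 := Finsupp.ext hm0
      exact MvPolynomial.mem_support_iff.1 hm h
  rw [this]
  exact RingHom.ker_isMaximal_of_surjective _ fun c => ⟨MvPolynomial.C c, by simp⟩

end GeometricSequence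

open AffineSG MvPolynomial in
/-- For the numerical semigroup minimally generated by the geometric sequence
`a^r, a^{r-1}b, …, b^r` (`gcd(a,b) = 1`, `a < b`), the binomials
`P_1 = z_2^a − z_1^b, …, P_r = z_{r+1}^a − z_r^b` form a regular sequence in
`A = k[z_1,…,z_{r+1}]`; consequently (the Koszul complex on `P_1,…,P_r` being a minimal free
resolution of `A/𝔭`) the Betti numbers are `β_i^A(A/𝔭) = C(r,i)` for all `i`. -/
theorem geom_regular_sequence_betti {k : Type} [Field k] (a b r : ℕ)
    (ha : 0 < a) (hab : a < b) (hco : Nat.Coprime a b) (hr : 0 < r) :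
    RingTheory.Sequence.IsRegular (MvPolynomial (Fin (r + 1)) k)
        (List.ofFn (geomP k a b r)) ∧
      ∀ i : ℕ,
        bettiNumber (MvPolynomial (Fin (r + 1)) k)
            (Ideal.span (Set.range
              (MvPolynomial.X : Fin (r + 1) → MvPolynomial (Fin (r + 1)) k)))
            (MvPolynomial (Fin (r + 1)) k ⧸ geomKer k a b r) i =
          (r.choose i : WithBot ℕ∞) := by
  refine ⟨isRegular_geomP ha (ha.trans hab), fun i => ?_⟩
  have := isMaximal_span_range_X (k := k) (σ := Fin (r + 1))
  have hmem : ∀ x ∈ List.ofFn (geomP k a b r), x ∈ Ideal.span (Set.range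
      (MvPolynomial.X : Fin (r + 1) → MvPolynomial (Fin (r + 1)) k)) := by
    have hX (i : Fin (r + 1)) : (MvPolynomial.X i : MvPolynomial (Fin (r + 1)) k) ∈
        Ideal.span (Set.range X) := Ideal.subset_span ⟨i, rfl⟩
    intro x hx
    obtain ⟨i, rfl⟩ := List.mem_ofFn.1 hx
    exact sub_mem (Ideal.pow_mem_of_mem _ (hX _) _ ha)
      (Ideal.pow_mem_of_mem _ (hX _) _ (ha.trans hab))
  obtain ⟨Q⟩ := MinimalFreeResolution.nonempty_of_isWeaklyRegular _ hmem _ 0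
    (MinimalFreeResolution.self _) (isWeaklyRegular_geomP ha)
  rw [List.length_ofFn, zero_add] at Q
  refine (Q.congr (Submodule.quotEquivOfEq _ _ ?_)).bettiNumber_eq i
  rw [smul_eq_mul, Ideal.mul_top, ofList_ofFn_geomP, span_geomP_eq_geomKer ha hco]
end
end
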